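/- arXiv:1806.09305 — 5 statements merged into one kernel-verified Lean document; each statement's English description precedes it below -/
import Mathlib

section
/- Let (T,X) be a minimal semiflow, let (T,Y) be a semiflow admitting an invariant regular Borel probability measure μ, and let J be a closed invariant subset of X × Y. Define the McMahon pseudo-metric D_J(x,x′) = μ(J_x △ J_{x′}), where J_x = { y ∈ Y : (x,y) ∈ J } and △ denotes symmetric difference. Then D_J is a continuous pseudo-metric on X × X and is T-invariant: D_J(tx, tx′) = D_J(x,x′) for all t ∈ T and x,x′ ∈ X. -/
open Filter Topology Set Function MeasureTheory
open scoped Uniformity symmDiff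

universe u v

/-- The orbit `T x` of a point `x` under the action of `T`. -/
def orbitSet (T : Type*) {X : Type*} [SMul T X] (x : X) : Set X :=
  Set.range fun t : T => t • x

/-- A semiflow is minimal iff every orbit is dense. -/
def SFMinimal (T : Type*) (X : Type*) [SMul T X] [TopologicalSpace X] : Prop :=
  ∀ x : X, Dense (orbitSet T x)

/-- `μ` is an invariant (Borel) probability measure for the semiflow `(T,X)`:
`μ (t⁻¹ B) = μ B` for every Borel set `B` and every `t ∈ T`. -/
def SFInvariantMeasure (T : Type*) {X : Type*} [SMul T X] [MeasurableSpace X]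
    (μ : Measure X) : Prop :=
  IsProbabilityMeasure μ ∧
    ∀ (t : T) (B : Set X), MeasurableSet B → μ ((fun x => t • x) ⁻¹' B) = μ B

/-- Topological transitivity: for all nonempty open `U V`, some `t` has `U ∩ t⁻¹V ≠ ∅`. -/
def SFTopTransitive (T : Type*) (X : Type*) [SMul T X] [TopologicalSpace X] : Prop :=
  ∀ U V : Set X, IsOpen U → U.Nonempty → IsOpen V → V.Nonempty →
    ∃ t : T, (U ∩ (fun x => t • x) ⁻¹' V).Nonempty

/-- Weak mixing: the diagonal product semiflow on `X × X` is topologically transitive. -/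
def SFWeakMixing (T : Type*) (X : Type*) [SMul T X] [TopologicalSpace X] : Prop :=
  SFTopTransitive T (X × X)

/-- The regionally proximal relation `Q(X)`: `(x,x')` such that there are nets
`xₙ → x`, `xₙ' → x'` and `tₙ` in `T` with `lim tₙxₙ = lim tₙxₙ'`. -/
def SFRegionallyProximal (T : Type*) (X : Type*) [SMul T X] [UniformSpace X] :
    Set (X × X) :=
  ⋂ ε ∈ 𝓤 X, closure {p : X × X | ∃ t : T, (t • p.1, t • p.2) ∈ ε}

/-- Equicontinuity of a semiflow on a (compact) uniform space. -/
def SFEquicontinuous (T : Type*) (X : Type*) [SMul T X] [UniformSpace X] : Prop :=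
  ∀ ε ∈ 𝓤 X, ∃ δ ∈ 𝓤 X, ∀ p : X × X, p ∈ δ → ∀ t : T, (t • p.1, t • p.2) ∈ ε

/-- Distality of a semiflow. -/
def SFDistal (T : Type*) (X : Type*) [SMul T X] [UniformSpace X] : Prop :=
  ∀ x x' : X, x ≠ x' → ∃ ε ∈ 𝓤 X, ∀ t : T, (t • x, t • x') ∉ ε

/-- `x` and `y` are proximal: some net `tₙ` has `tₙx → z` and `tₙy → z`. -/
def SFProximal (T : Type*) {X : Type*} [SMul T X] [TopologicalSpace X] (x y : X) : Prop :=
  ∃ z : X, (z, z) ∈ closure (Set.range fun t : T => (t • x, t • y))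

/-- `x` is a distal point: no point of its orbit closure other than `x` is proximal to `x`. -/
def SFDistalPoint (T : Type*) {X : Type*} [SMul T X] [TopologicalSpace X] (x : X) : Prop :=
  ∀ y ∈ closure (orbitSet T x), SFProximal T x y → y = x

/-- A relation `R ⊆ X × X` is invariant under the action. -/
def SFInvariantRel (T : Type*) {X : Type*} [SMul T X] (R : Set (X × X)) : Prop :=
  ∀ (t : T), ∀ p ∈ R, (t • p.1, t • p.2) ∈ R

/-- `x` is a minimal (almost periodic) point: its orbit closure is a minimal set. -/
def SFMinimalPoint (T : Type*) {X : Type*} [SMul T X] [TopologicalSpace X] (x : X) : Prop :=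
  ∀ y ∈ closure (orbitSet T x), closure (orbitSet T y) = closure (orbitSet T x)

/-- `R` is the fiber relation of some equicontinuous factor of `(T,X)`; equivalently,
`R` is a closed invariant equivalence relation such that the induced semiflow on `X/R`
is equicontinuous. -/
def SFIsEqFactorRel (T : Type*) (X : Type u) [Monoid T] [TopologicalSpace T]
    [TopologicalSpace X] [MulAction T X] (R : Set (X × X)) : Prop :=
  ∃ (Y : Type u) (_ : UniformSpace Y) (_ : CompactSpace Y) (_ : T2Space Y)
    (_ : MulAction T Y) (_ : ContinuousSMul T Y) (π : X → Y),
      Continuous π ∧ Function.Surjective π ∧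
      (∀ (t : T) (x : X), π (t • x) = t • π x) ∧
      SFEquicontinuous T Y ∧ R = {p : X × X | π p.1 = π p.2}

/-- `S` is the equicontinuous structure relation `S_eq(X)`: the smallest closed invariant
equivalence relation whose quotient semiflow is equicontinuous. -/
def SFIsEqStructureRel (T : Type*) (X : Type u) [Monoid T] [TopologicalSpace T]
    [TopologicalSpace X] [MulAction T X] (S : Set (X × X)) : Prop :=
  SFIsEqFactorRel T X S ∧ ∀ R : Set (X × X), SFIsEqFactorRel T X R → S ⊆ R

/-- `R` is the fiber relation of some equicontinuous *and invertible* factor of `(T,X)`. -/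
def SFIsEqInvFactorRel (T : Type*) (X : Type u) [Monoid T] [TopologicalSpace T]
    [TopologicalSpace X] [MulAction T X] (R : Set (X × X)) : Prop :=
  ∃ (Y : Type u) (_ : UniformSpace Y) (_ : CompactSpace Y) (_ : T2Space Y)
    (_ : MulAction T Y) (_ : ContinuousSMul T Y) (π : X → Y),
      Continuous π ∧ Function.Surjective π ∧
      (∀ (t : T) (x : X), π (t • x) = t • π x) ∧
      SFEquicontinuous T Y ∧ (∀ t : T, Function.Bijective fun y : Y => t • y) ∧
      R = {p : X × X | π p.1 = π p.2}

/-- `(T,X)` has a nontrivial distal factor. -/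
def SFHasNontrivialDistalFactor (T : Type*) (X : Type u) [Monoid T] [TopologicalSpace T]
    [TopologicalSpace X] [MulAction T X] : Prop :=
  ∃ (Z : Type u) (_ : UniformSpace Z) (_ : CompactSpace Z) (_ : T2Space Z)
    (_ : MulAction T Z) (_ : ContinuousSMul T Z) (π : X → Z),
      Continuous π ∧ Function.Surjective π ∧
      (∀ (t : T) (x : X), π (t • x) = t • π x) ∧
      SFDistal T Z ∧ Nontrivial Z

/-- `(T,X)` has a nontrivial equicontinuous factor. -/
def SFHasNontrivialEqFactor (T : Type*) (X : Type u) [Monoid T] [TopologicalSpace T]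
    [TopologicalSpace X] [MulAction T X] : Prop :=
  ∃ (Z : Type u) (_ : UniformSpace Z) (_ : CompactSpace Z) (_ : T2Space Z)
    (_ : MulAction T Z) (_ : ContinuousSMul T Z) (π : X → Z),
      Continuous π ∧ Function.Surjective π ∧
      (∀ (t : T) (x : X), π (t • x) = t • π x) ∧
      SFEquicontinuous T Z ∧ Nontrivial Z

/-- `T` is amenable: every semiflow with phase semigroup `T` on a compact Hausdorff
space admits an invariant Borel probability measure. -/
def SFAmenable (T : Type*) [Monoid T] [TopologicalSpace T] : Prop :=
  ∀ (Y : Type u) (_ : TopologicalSpace Y) (_ : CompactSpace Y) (_ : T2Space Y)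
    (_ : MulAction T Y) (_ : ContinuousSMul T Y) (_ : MeasurableSpace Y) (_ : BorelSpace Y),
    ∃ μ : Measure Y, SFInvariantMeasure T μ

/-- `A ⊆ T` is discretely thick: every finite `F ⊆ T` has `F t ⊆ A` for some `t`. -/
def DiscretelyThick (T : Type*) [Monoid T] (A : Set T) : Prop :=
  ∀ F : Finset T, ∃ t : T, ∀ f ∈ F, f * t ∈ A

/-- `A ⊆ T` is discretely syndetic: for some finite `K ⊆ T`, `K t ∩ A ≠ ∅` for all `t`. -/
def DiscretelySyndetic (T : Type*) [Monoid T] (A : Set T) : Prop :=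
  ∃ K : Finset T, ∀ t : T, ∃ k ∈ K, k * t ∈ A

/-- `x` is a locally almost periodic point. -/
def SFLapPoint (T : Type*) {X : Type*} [Monoid T] [SMul T X] [TopologicalSpace X]
    (x : X) : Prop :=
  ∀ U ∈ 𝓝 x, ∃ V ∈ 𝓝 x, ∃ A : Set T, DiscretelySyndetic T A ∧
    ∀ a ∈ A, ∀ y ∈ V, a • y ∈ U

/-- `(T,Y)` is an E-semiflow: topologically transitive with full ergodic center,
i.e. the only closed invariant subset of full measure for every invariant measure
is `Y` itself. -/
def SFIsESemiflow (T : Type*) (Y : Type*) [SMul T Y] [TopologicalSpace Y]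
    [MeasurableSpace Y] : Prop :=
  SFTopTransitive T Y ∧
    ∀ C : Set Y, IsClosed C → (∀ (t : T), ∀ y ∈ C, t • y ∈ C) →
      (∀ μ : Measure Y, SFInvariantMeasure T μ → μ C = 1) → C = Set.univ

/-- Veech's relation `V`: `x' ∈ V[x]` iff there are a net `xₙ' → x'`, a point `y`, and a
net `tₙ` in `T` with `tₙ x → y` and `tₙ xₙ' = y`. -/
def SFVeechV (T : Type*) {X : Type*} [SMul T X] [UniformSpace X] (x : X) : Set X :=
  {x' : X | ∃ y : X, ∀ ε ∈ 𝓤 X, ∃ (x'' : X) (t : T),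
    (x', x'') ∈ ε ∧ (y, t • x) ∈ ε ∧ t • x'' = y}

/-- Veech's relation `D`: `D[x] = ⋂_ε cls (A⁻¹ A x)` where `A = N_T(x, ε[x])`. -/
def SFVeechD (T : Type*) {X : Type*} [SMul T X] [UniformSpace X] (x : X) : Set X :=
  ⋂ ε ∈ 𝓤 X, closure {z : X | ∃ t : T, (x, t • x) ∈ ε ∧
    ∃ s : T, (x, s • x) ∈ ε ∧ t • z = s • x}

/-- `x` is an almost automorphic point: `V[x] = {x}`, i.e. whenever `tₙ x → y`,
`xₙ' → x'`, `tₙ xₙ' = y`, then `x = x'`. -/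
def SFAAPoint (T : Type*) {X : Type*} [SMul T X] [UniformSpace X] (x : X) : Prop :=
  ∀ x' ∈ SFVeechV T x, x' = x

/-- A surjective semiflow is bi-continuous if each set-valued map `x ↦ t⁻¹x` is continuous. -/
def SFBiContinuous (T : Type*) (X : Type*) [SMul T X] [UniformSpace X] : Prop :=
  (∀ t : T, Function.Surjective fun x : X => t • x) ∧
  ∀ (t : T) (x₀ : X), ∀ ε ∈ 𝓤 X, ∃ δ ∈ 𝓤 X, ∀ x : X, (x₀, x) ∈ δ →
    (∀ z : X, t • z = x → ∃ w : X, t • w = x₀ ∧ (w, z) ∈ ε) ∧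
    (∀ w : X, t • w = x₀ → ∃ z : X, t • z = x ∧ (w, z) ∈ ε)

/-- The McMahon pseudo-metric `D_J(x,x') = μ (J_x △ J_{x'})`. -/
noncomputable def mcmahonDJ {X : Type*} {Y : Type*} [MeasurableSpace Y] (μ : Measure Y)
    (J : Set (X × Y)) (x x' : X) : ℝ :=
  (μ ({y : Y | (x, y) ∈ J} ∆ {y : Y | (x', y) ∈ J})).toReal

section McMahon

variable {T : Type*} {X : Type*} {Y : Type*}

/-- Tube lemma for sections: the points whose section lies in an open set form an open set. -/
theorem eventually_section_subset [TopologicalSpace X] [TopologicalSpace Y] [CompactSpace Y]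
    {J : Set (X × Y)} (hJ : IsClosed J) {U : Set Y} (hU : IsOpen U) {a : X}
    (ha : {y | (a, y) ∈ J} ⊆ U) : ∀ᶠ x in 𝓝 a, {y | (x, y) ∈ J} ⊆ U := by
  have hclosed : IsClosed (Prod.fst '' (J ∩ Prod.snd ⁻¹' Uᶜ)) :=
    isClosedMap_fst_of_compactSpace _ (hJ.inter (hU.isClosed_compl.preimage continuous_snd))
  have hmem : (Prod.fst '' (J ∩ Prod.snd ⁻¹' Uᶜ))ᶜ ∈ 𝓝 a := by
    refine hclosed.isOpen_compl.mem_nhds ?_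
    rintro ⟨⟨x, y⟩, ⟨hxy, hyU⟩, rfl⟩
    exact hyU (ha hxy)
  filter_upwards [hmem] with x hx y hy
  by_contra hyU
  exact hx ⟨(x, y), ⟨hy, hyU⟩, rfl⟩

theorem isClosed_section [TopologicalSpace X] [TopologicalSpace Y]
    {J : Set (X × Y)} (hJ : IsClosed J) (x : X) : IsClosed {y | (x, y) ∈ J} :=
  hJ.preimage (Continuous.prodMk_right x)

theorem measurableSet_section [TopologicalSpace X] [TopologicalSpace Y]
    [MeasurableSpace Y] [BorelSpace Y]
    {J : Set (X × Y)} (hJ : IsClosed J) (x : X) : MeasurableSet {y | (x, y) ∈ J} :=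
  (isClosed_section hJ x).measurableSet

/-- The measure of the sections of a closed set is upper semicontinuous. -/
theorem upperSemicontinuous_measure_section [TopologicalSpace X] [TopologicalSpace Y]
    [CompactSpace Y] [MeasurableSpace Y] (μ : Measure Y) [μ.OuterRegular]
    {J : Set (X × Y)} (hJ : IsClosed J) :
    UpperSemicontinuous fun x => μ {y | (x, y) ∈ J} := by
  intro a c hc
  obtain ⟨U, haU, hU, hUc⟩ := Set.exists_isOpen_lt_of_lt _ c hc
  filter_upwards [eventually_section_subset hJ hU haU] with x hx
  exact (measure_mono hx).trans_lt hUc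

theorem measure_section_eq_of_minimal [SMul T X] [TopologicalSpace X] [SMul T Y]
    [TopologicalSpace Y] [CompactSpace Y] [MeasurableSpace Y] [BorelSpace Y]
    (hmin : SFMinimal T X) {μ : Measure Y} [μ.OuterRegular] (hμ : SFInvariantMeasure T μ)
    {J : Set (X × Y)} (hJ : IsClosed J) (hJinv : ∀ (t : T), ∀ p ∈ J, (t • p.1, t • p.2) ∈ J)
    (x x' : X) : μ {y | (x, y) ∈ J} = μ {y | (x', y) ∈ J} := by
  have key : ∀ a b : X, μ {y | (a, y) ∈ J} ≤ μ {y | (b, y) ∈ J} := by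
    intro a b
    have hclosed : IsClosed {x | μ {y | (a, y) ∈ J} ≤ μ {y | (x, y) ∈ J}} :=
      (upperSemicontinuous_measure_section μ hJ).isClosed_preimage _
    have horbit : orbitSet T a ⊆ {x | μ {y | (a, y) ∈ J} ≤ μ {y | (x, y) ∈ J}} := by
      rintro _ ⟨t, rfl⟩
      rw [Set.mem_ofPred_eq, ← hμ.2 t _ (measurableSet_section hJ (t • a))]
      exact measure_mono fun y hy => hJinv t (a, y) hy
    exact hclosed.closure_subset_iff.2 horbit (hmin a b)
  exact le_antisymm (key _ _) (key _ _)

theorem mcmahonDJ_comm [MeasurableSpace Y] (μ : Measure Y) (J : Set (X × Y)) (x x' : X) :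
    mcmahonDJ μ J x x' = mcmahonDJ μ J x' x := by
  rw [mcmahonDJ, mcmahonDJ, symmDiff_comm]

theorem mcmahonDJ_triangle [MeasurableSpace Y] (μ : Measure Y) [IsFiniteMeasure μ]
    (J : Set (X × Y)) (x x' x'' : X) :
    mcmahonDJ μ J x x'' ≤ mcmahonDJ μ J x x' + mcmahonDJ μ J x' x'' :=
  (measureReal_mono (symmDiff_triangle _ _ _)).trans (measureReal_union_le _ _)

/-- If all sections of a closed set have the same measure, then nearby sections differ little. -/
theorem tendsto_mcmahonDJ_zero [TopologicalSpace X] [TopologicalSpace Y]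
    [CompactSpace Y] [MeasurableSpace Y] [BorelSpace Y] (μ : Measure Y) [IsFiniteMeasure μ]
    [μ.OuterRegular] {J : Set (X × Y)} (hJ : IsClosed J)
    (hconst : ∀ x x', μ {y | (x, y) ∈ J} = μ {y | (x', y) ∈ J}) (a : X) :
    Tendsto (fun x => mcmahonDJ μ J x a) (𝓝 a) (𝓝 0) := by
  refine tendsto_order.2 ⟨fun c hc => Eventually.of_forall fun x =>
    hc.trans_le ENNReal.toReal_nonneg, fun ε hε => ?_⟩
  obtain ⟨U, haU, hU, hUε⟩ := Set.exists_isOpen_lt_add {y | (a, y) ∈ J}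
    (measure_ne_top μ _) (ENNReal.ofReal_pos.2 (half_pos hε)).ne'
  have hlt : μ.real U < μ.real {y | (a, y) ∈ J} + ε / 2 := by
    have := (ENNReal.toReal_lt_toReal (measure_ne_top μ _) (by finiteness)).2 hUε
    rwa [ENNReal.toReal_add (measure_ne_top μ _) ENNReal.ofReal_ne_top,
      ENNReal.toReal_ofReal (half_pos hε).le] at this
  filter_upwards [eventually_section_subset hJ hU haU] with x hx
  have hxa : μ.real {y | (x, y) ∈ J} = μ.real {y | (a, y) ∈ J} :=
    congrArg ENNReal.toReal (hconst x a)
  have hD : mcmahonDJ μ J x a = μ.real ({y | (x, y) ∈ J} \ {y | (a, y) ∈ J}) +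
      μ.real ({y | (a, y) ∈ J} \ {y | (x, y) ∈ J}) :=
    measureReal_symmDiff_eq (measurableSet_section hJ x) (measurableSet_section hJ a)
  have h₁ : μ.real ({y | (x, y) ∈ J} \ {y | (a, y) ∈ J}) ≤
      μ.real U - μ.real {y | (a, y) ∈ J} :=
    (measureReal_mono (sdiff_subset_sdiff_left hx)).trans_eq
      (measureReal_sdiff haU (measurableSet_section hJ a))
  have h₂ : μ.real ({y | (a, y) ∈ J} \ {y | (x, y) ∈ J}) ≤
      μ.real U - μ.real {y | (x, y) ∈ J} :=
    (measureReal_mono (sdiff_subset_sdiff_left haU)).trans_eq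
      (measureReal_sdiff hx (measurableSet_section hJ x))
  linarith

theorem continuous_mcmahonDJ [TopologicalSpace X] [TopologicalSpace Y]
    [CompactSpace Y] [MeasurableSpace Y] [BorelSpace Y] (μ : Measure Y) [IsFiniteMeasure μ]
    [μ.OuterRegular] {J : Set (X × Y)} (hJ : IsClosed J)
    (hconst : ∀ x x', μ {y | (x, y) ∈ J} = μ {y | (x', y) ∈ J}) :
    Continuous fun p : X × X => mcmahonDJ μ J p.1 p.2 := by
  refine continuous_iff_continuousAt.2 fun ⟨a, b⟩ => ?_
  have hbound : Tendsto (fun p : X × X => mcmahonDJ μ J p.1 a + mcmahonDJ μ J p.2 b)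
      (𝓝 (a, b)) (𝓝 0) := by
    simpa using ((tendsto_mcmahonDJ_zero μ hJ hconst a).comp (continuous_fst.tendsto (a, b))).add
      ((tendsto_mcmahonDJ_zero μ hJ hconst b).comp (continuous_snd.tendsto (a, b)))
  refine tendsto_iff_dist_tendsto_zero.2
    (squeeze_zero (fun _ => dist_nonneg) (fun p => ?_) hbound)
  have h₁ := mcmahonDJ_triangle μ J p.1 a p.2
  have h₂ := mcmahonDJ_triangle μ J a b p.2
  have h₃ := mcmahonDJ_triangle μ J a p.1 b
  have h₄ := mcmahonDJ_triangle μ J p.1 p.2 b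
  rw [mcmahonDJ_comm μ J b p.2] at h₂
  rw [mcmahonDJ_comm μ J a p.1] at h₃
  rw [Real.dist_eq, abs_le]
  constructor <;> linarith

theorem mcmahonDJ_smul [TopologicalSpace X] [SMul T X] [TopologicalSpace Y] [SMul T Y]
    [ContinuousConstSMul T Y] [MeasurableSpace Y] [BorelSpace Y]
    {μ : Measure Y} (hμ : SFInvariantMeasure T μ) {J : Set (X × Y)} (hJ : IsClosed J)
    (hJinv : ∀ (t : T), ∀ p ∈ J, (t • p.1, t • p.2) ∈ J)
    (hconst : ∀ x x', μ {y | (x, y) ∈ J} = μ {y | (x', y) ∈ J}) (t : T) (x x' : X) :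
    mcmahonDJ μ J (t • x) (t • x') = mcmahonDJ μ J x x' := by
  have := hμ.1
  have hae : ∀ z : X, ({y | (z, y) ∈ J} : Set Y) =ᵐ[μ]
      (fun y => t • y) ⁻¹' {y | (t • z, y) ∈ J} := fun z =>
    ae_eq_of_subset_of_measure_ge (fun y hy => hJinv t (z, y) hy)
      (by rw [hμ.2 t _ (measurableSet_section hJ _), hconst (t • z) z])
      (measurableSet_section hJ z).nullMeasurableSet (measure_ne_top μ _)
  refine congrArg ENNReal.toReal ?_
  rw [← hμ.2 t _ ((measurableSet_section hJ _).symmDiff (measurableSet_section hJ _))]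
  exact measure_congr ((hae x).symmDiff (hae x')).symm

end McMahon

/-- The McMahon pseudo-metric `D_J(x,x') = μ(J_x △ J_{x'})` is a
continuous pseudo-metric on `X` which is `T`-invariant. -/
theorem stmt13 (T : Type*) (X : Type u) (Y : Type v) [Monoid T] [TopologicalSpace T]
    [TopologicalSpace X] [CompactSpace X] [T2Space X]
    [MulAction T X] [ContinuousSMul T X]
    [TopologicalSpace Y] [CompactSpace Y] [T2Space Y]
    [MulAction T Y] [ContinuousSMul T Y]
    [MeasurableSpace Y] [BorelSpace Y]
    (hmin : SFMinimal T X)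
    (μ : Measure Y) (hμ : SFInvariantMeasure T μ) (hreg : μ.Regular)
    (J : Set (X × Y)) (hJclosed : IsClosed J)
    (hJinv : ∀ (t : T), ∀ p ∈ J, (t • p.1, t • p.2) ∈ J) :
    Continuous (fun p : X × X => mcmahonDJ μ J p.1 p.2) ∧
    (∀ x : X, mcmahonDJ μ J x x = 0) ∧
    (∀ x x' : X, 0 ≤ mcmahonDJ μ J x x') ∧
    (∀ x x' : X, mcmahonDJ μ J x x' = mcmahonDJ μ J x' x) ∧
    (∀ x x' x'' : X, mcmahonDJ μ J x x'' ≤ mcmahonDJ μ J x x' + mcmahonDJ μ J x' x'') ∧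
    (∀ (t : T) (x x' : X), mcmahonDJ μ J (t • x) (t • x') = mcmahonDJ μ J x x') := by
  have := hμ.1
  have hconst := measure_section_eq_of_minimal hmin hμ hJclosed hJinv
  exact ⟨continuous_mcmahonDJ μ hJclosed hconst, fun x => by simp [mcmahonDJ],
    fun _ _ => ENNReal.toReal_nonneg, mcmahonDJ_comm μ J, mcmahonDJ_triangle μ J,
    mcmahonDJ_smul hμ hJclosed hJinv hconst⟩
end

section
/- Let (T,X) be a minimal semiflow, let (T,Y) be a semiflow admitting an invariant regular Borel probability measure μ, and let J be a closed invariant subset of X × Y with McMahon pseudo-metric D_J(x,x′) = μ(J_x △ J_{x′}). Define R_J = { (x,x′) ∈ X × X : D_J(x,x′) = 0 }. Then R_J is a closed T-invariant equivalence relation on X which contains the regionally proximal relation Q(X). -/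
open Filter Topology Set Function MeasureTheory
open scoped Uniformity symmDiff

universe u v

/-- If an open set contains a fibre of a closed relation with compact target, then it contains
all nearby fibres. -/
lemma eventually_fiber_subset {Z Y : Type*} [TopologicalSpace Z] [TopologicalSpace Y]
    [CompactSpace Y] {K : Set (Z × Y)} (hK : IsClosed K) {z : Z} {U : Set Y} (hU : IsOpen U)
    (h : {y | (z, y) ∈ K} ⊆ U) : ∀ᶠ z' in 𝓝 z, {y | (z', y) ∈ K} ⊆ U := by
  have key : ∀ᶠ z' in 𝓝 z, ∀ y ∈ (univ : Set Y), (z', y) ∈ Kᶜ ∪ Prod.snd ⁻¹' U := by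
    refine isCompact_univ.eventually_forall_of_forall_eventually fun y _ => ?_
    refine (hK.isOpen_compl.union (hU.preimage continuous_snd)).mem_nhds ?_
    by_cases hy : (z, y) ∈ K
    · exact Or.inr (h hy)
    · exact Or.inl hy
  filter_upwards [key] with z' hz' y hy
  exact (hz' y (mem_univ y)).resolve_left fun hn => hn hy

/-- The measure of the fibres of a closed relation is upper semicontinuous. -/
lemma isClosed_le_measure_fiber {Z Y : Type*} [TopologicalSpace Z] [TopologicalSpace Y]
    [CompactSpace Y] [MeasurableSpace Y] (μ : Measure Y) [μ.OuterRegular] {K : Set (Z × Y)}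
    (hK : IsClosed K) (r : ENNReal) : IsClosed {z | r ≤ μ {y | (z, y) ∈ K}} := by
  rw [← isOpen_compl_iff, isOpen_iff_mem_nhds]
  intro z hz
  obtain ⟨U, hKU, hU, hμU⟩ := Set.exists_isOpen_lt_of_lt _ r (not_le.mp hz)
  filter_upwards [eventually_fiber_subset hK hU hKU] with z' hz'
  exact not_le.mpr ((measure_mono hz').trans_lt hμU)

/-- In a minimal semiflow, all fibres of a closed invariant relation have the same measure. -/
lemma SFMinimal.measure_fiber_eq {T X Y : Type*} [TopologicalSpace X] [SMul T X]
    [TopologicalSpace Y] [CompactSpace Y] [SMul T Y] [ContinuousConstSMul T Y]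
    [MeasurableSpace Y] [BorelSpace Y] (hmin : SFMinimal T X) {μ : Measure Y} [μ.OuterRegular]
    (hμ : SFInvariantMeasure T μ) {J : Set (X × Y)} (hJ : IsClosed J)
    (hJinv : ∀ (t : T), ∀ p ∈ J, (t • p.1, t • p.2) ∈ J) (x x' : X) :
    μ {y | (x, y) ∈ J} = μ {y | (x', y) ∈ J} := by
  have le (a b : X) : μ {y | (a, y) ∈ J} ≤ μ {y | (b, y) ∈ J} := by
    have hsub : orbitSet T a ⊆ {b | μ {y | (a, y) ∈ J} ≤ μ {y | (b, y) ∈ J}} := by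
      rintro _ ⟨t, rfl⟩
      have meas : MeasurableSet {y | (t • a, y) ∈ J} :=
        (hJ.preimage (Continuous.prodMk_right (t • a))).measurableSet
      exact (measure_mono fun y hy => hJinv t (a, y) hy).trans_eq (hμ.2 t _ meas)
    exact closure_minimal hsub (isClosed_le_measure_fiber μ hJ _) (hmin a b)
  exact (le x x').antisymm (le x' x)

/-- In a minimal semiflow, the fibres of a closed invariant relation are equivariant up to
null sets. -/
lemma SFMinimal.fiber_ae_eq_preimage {T X Y : Type*} [TopologicalSpace X] [SMul T X]
    [TopologicalSpace Y] [CompactSpace Y] [SMul T Y] [ContinuousConstSMul T Y]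
    [MeasurableSpace Y] [BorelSpace Y] (hmin : SFMinimal T X) {μ : Measure Y} [μ.OuterRegular]
    (hμ : SFInvariantMeasure T μ) {J : Set (X × Y)} (hJ : IsClosed J)
    (hJinv : ∀ (t : T), ∀ p ∈ J, (t • p.1, t • p.2) ∈ J) (t : T) (x : X) :
    {y | (x, y) ∈ J} =ᵐ[μ] (fun y => t • y) ⁻¹' {y | (t • x, y) ∈ J} := by
  have := hμ.1
  have meas (x : X) : MeasurableSet {y | (x, y) ∈ J} :=
    (hJ.preimage (Continuous.prodMk_right x)).measurableSet
  refine ae_eq_of_subset_of_measure_ge (fun y hy => hJinv t (x, y) hy) ?_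
    (meas x).nullMeasurableSet (measure_ne_top μ _)
  rw [hμ.2 t _ (meas _), hmin.measure_fiber_eq hμ hJ hJinv (t • x) x]

/-- The relation `R_J = {(x,x') : D_J(x,x') = 0}` induced by the McMahon
pseudo-metric is a closed `T`-invariant equivalence relation on `X` containing the
regionally proximal relation `Q(X)`. -/
theorem stmt14 (T : Type*) (X : Type u) (Y : Type v) [Monoid T] [TopologicalSpace T]
    [UniformSpace X] [CompactSpace X] [T2Space X]
    [MulAction T X] [ContinuousSMul T X]
    [TopologicalSpace Y] [CompactSpace Y] [T2Space Y]
    [MulAction T Y] [ContinuousSMul T Y]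
    [MeasurableSpace Y] [BorelSpace Y]
    (hmin : SFMinimal T X)
    (μ : Measure Y) (hμ : SFInvariantMeasure T μ) (hreg : μ.Regular)
    (J : Set (X × Y)) (hJclosed : IsClosed J)
    (hJinv : ∀ (t : T), ∀ p ∈ J, (t • p.1, t • p.2) ∈ J) :
    IsClosed {p : X × X | μ ({y : Y | (p.1, y) ∈ J} ∆ {y : Y | (p.2, y) ∈ J}) = 0} ∧
    SFInvariantRel T {p : X × X | μ ({y : Y | (p.1, y) ∈ J} ∆ {y : Y | (p.2, y) ∈ J}) = 0} ∧
    Equivalence (fun x x' : X => μ ({y : Y | (x, y) ∈ J} ∆ {y : Y | (x', y) ∈ J}) = 0) ∧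
    SFRegionallyProximal T X ⊆
      {p : X × X | μ ({y : Y | (p.1, y) ∈ J} ∆ {y : Y | (p.2, y) ∈ J}) = 0} := by
  have := hμ.1
  have meas (x : X) : MeasurableSet {y | (x, y) ∈ J} :=
    (hJclosed.preimage (Continuous.prodMk_right x)).measurableSet
  have heq := hmin.measure_fiber_eq hμ hJclosed hJinv
  have hae := hmin.fiber_ae_eq_preimage hμ hJclosed hJinv
  let h : X × X → ENNReal := fun p => μ ({y | (p.1, y) ∈ J} ∩ {y | (p.2, y) ∈ J})
  have h_smul (t : T) (p : X × X) : h (t • p.1, t • p.2) = h p := by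
    change μ _ = μ _
    rw [← hμ.2 t _ ((meas _).inter (meas _)), preimage_inter]
    exact (measure_congr ((hae t p.1).inter (hae t p.2))).symm
  have h_closed (r : ENNReal) : IsClosed {p | r ≤ h p} :=
    isClosed_le_measure_fiber μ (K := {q : (X × X) × Y | (q.1.1, q.2) ∈ J ∧ (q.1.2, q.2) ∈ J})
      ((hJclosed.preimage (by fun_prop)).inter (hJclosed.preimage (by fun_prop))) r
  have h_iff (p : X × X) : μ ({y : Y | (p.1, y) ∈ J} ∆ {y : Y | (p.2, y) ∈ J}) = 0 ↔
      μ {y | (p.1, y) ∈ J} ≤ h p := by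
    rw [measure_symmDiff_eq_zero_iff]
    constructor
    · intro hp
      have hinter := (ae_eq_refl {y | (p.1, y) ∈ J}).inter hp
      rw [inter_self] at hinter
      exact (measure_congr hinter).le
    · intro hp
      have h1 := ae_eq_of_subset_of_measure_ge inter_subset_left hp
        ((meas p.1).inter (meas p.2)).nullMeasurableSet (measure_ne_top μ _)
      have h2 := ae_eq_of_subset_of_measure_ge inter_subset_right
        ((heq p.2 p.1).le.trans hp)
        ((meas p.1).inter (meas p.2)).nullMeasurableSet (measure_ne_top μ _)
      exact h1.symm.trans h2
  refine ⟨?_, ?_, ⟨?_, ?_, ?_⟩, ?_⟩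
  · refine isClosed_of_closure_subset fun p hp =>
      (h_iff p).2 ((h_closed _).closure_subset_iff.2 (fun q hq => ?_) hp)
    exact (heq p.1 q.1).le.trans ((h_iff q).1 hq)
  · intro t p hp
    refine (h_iff _).2 ?_
    rw [h_smul, heq _ p.1]
    exact (h_iff p).1 hp
  · intro x
    simp
  · intro x x' hx
    rwa [symmDiff_comm]
  · intro x x' x'' hx hx'
    rw [measure_symmDiff_eq_zero_iff] at *
    exact hx.trans hx'
  · intro p hp
    refine (h_iff p).2 (le_of_forall_lt_imp_le_of_dense fun r hr => ?_)
    have hdiag : {q | r ≤ h q} ∈ 𝓤 X := by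
      rw [← nhdsSet_diagonal_eq_uniformity, mem_nhdsSet_iff_forall]
      rintro ⟨x, _⟩ ⟨⟩
      rw [heq p.1 x] at hr
      obtain ⟨U, hJU, hU, hμU⟩ := Set.exists_isOpen_lt_of_lt {y | (x, y) ∈ J}
        (μ {y | (x, y) ∈ J} + (μ {y | (x, y) ∈ J} - r))
        (ENNReal.lt_add_right (measure_ne_top μ _) (tsub_pos_of_lt hr).ne')
      have hev := eventually_fiber_subset hJclosed hU hJU
      filter_upwards [hev.prod_nhds hev] with q hq
      by_contra! hlt : h q < r
      have hunion := measure_union_add_inter (μ := μ) {y | (q.1, y) ∈ J} (meas q.2)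
      rw [heq q.1 x, heq q.2 x] at hunion
      refine (ENNReal.add_lt_add ((measure_mono (union_subset hq.1 hq.2)).trans_lt hμU)
        hlt).ne ?_
      rw [hunion, add_assoc, tsub_add_cancel_of_le hr.le]
    refine (h_closed r).closure_subset_iff.2 ?_ (mem_iInter₂.1 hp _ hdiag)
    rintro q ⟨t, ht⟩
    exact (h_smul t q).le.trans' ht
end

section
/- Let (T,X) be a minimal semiflow which admits an invariant measure. Then for x,y ∈ X the following are pairwise equivalent: (1) (x,y) ∈ Q(X); (2) there are nets {x_n} in X and {t_n} in T with x_n → x, t_n x_n → x and t_n y → x; (3) there are nets {x_n} in X and {s_n} in T with x_n → x, s_n x_n → y and s_n y → y. -/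
open Filter Topology Set Function MeasureTheory
open scoped Uniformity symmDiff

universe u v

theorem IsClosed.fiber {X Y : Type*} [TopologicalSpace X] [TopologicalSpace Y] {M : Set (X × Y)}
    (hM : IsClosed M) (x : X) : IsClosed (Prod.mk x ⁻¹' M) :=
  hM.preimage (by fun_prop)

theorem measure_diff_le_add_measure_diff {Y : Type*} [MeasurableSpace Y] {ν : Measure Y}
    (A B C : Set Y) : ν (A \ C) ≤ ν (A \ B) + ν (B \ C) := by
  refine (measure_mono fun y hy => ?_).trans (measure_union_le _ _)
  by_cases hB : y ∈ B
  · exact Or.inr ⟨hB, hy.2⟩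
  · exact Or.inl ⟨hy.1, hB⟩

section FiberMeasure

variable {T X Y : Type*} [Monoid T]
  [TopologicalSpace X] [MulAction T X]
  [TopologicalSpace Y] [CompactSpace Y]

/-- The fibers of a closed relation with compact second factor vary upper semicontinuously. -/
theorem IsClosed.eventually_fiber_subset {M : Set (X × Y)} (hM : IsClosed M) {x : X} {W : Set Y}
    (hW : IsOpen W) (hxW : Prod.mk x ⁻¹' M ⊆ W) : ∀ᶠ x' in 𝓝 x, Prod.mk x' ⁻¹' M ⊆ W := by
  have hcl : IsClosed (Prod.fst '' (M ∩ Prod.snd ⁻¹' Wᶜ)) :=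
    isClosedMap_fst_of_compactSpace _ (hM.inter (hW.isClosed_compl.preimage continuous_snd))
  have hx : x ∉ Prod.fst '' (M ∩ Prod.snd ⁻¹' Wᶜ) := by
    rintro ⟨⟨a, b⟩, ⟨hab, hb⟩, rfl⟩
    exact hb (hxW hab)
  filter_upwards [hcl.isOpen_compl.mem_nhds hx] with x' hx' y hy
  by_contra hyW
  exact hx' ⟨(x', y), ⟨hy, hyW⟩, rfl⟩

variable [MeasurableSpace Y] [BorelSpace Y] {ν : Measure Y}

variable [IsFiniteMeasure ν]

theorem eventually_measure_fiber_diff_lt [ν.OuterRegular] {M : Set (X × Y)} (hM : IsClosed M)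
    (x : X) {ε : ENNReal} (hε : ε ≠ 0) :
    ∀ᶠ x' in 𝓝 x, ν (Prod.mk x' ⁻¹' M \ Prod.mk x ⁻¹' M) < ε := by
  obtain ⟨W, hsub, hW, -, hlt⟩ :=
    (hM.fiber x).measurableSet.exists_isOpen_sdiff_lt (measure_ne_top ν _) hε
  filter_upwards [hM.eventually_fiber_subset hW hsub] with x' hx'
  exact (measure_mono (sdiff_subset_sdiff_left hx')).trans_lt hlt

variable [MulAction T Y]

/-- By minimality, the measure of the fibers of a closed invariant relation is constant. -/
theorem measure_fiber_eq [ν.OuterRegular] (hmin : SFMinimal T X) (hν : SFInvariantMeasure T ν)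
    {M : Set (X × Y)} (hM : IsClosed M) (hinv : ∀ (t : T), ∀ p ∈ M, (t • p.1, t • p.2) ∈ M)
    (a b : X) : ν (Prod.mk a ⁻¹' M) = ν (Prod.mk b ⁻¹' M) := by
  suffices h : ∀ a b : X, ν (Prod.mk a ⁻¹' M) ≤ ν (Prod.mk b ⁻¹' M) from
    le_antisymm (h a b) (h b a)
  intro a b
  refine ENNReal.le_of_forall_pos_le_add fun ε hε _ => ?_
  have hev := eventually_measure_fiber_diff_lt (ν := ν) hM b
    (ENNReal.coe_ne_zero.2 hε.ne')
  obtain ⟨_, ⟨t, rfl⟩, ht⟩ := (hmin a).inter_nhds_nonempty hev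
  calc ν (Prod.mk a ⁻¹' M) ≤ ν ((fun y => t • y) ⁻¹' (Prod.mk (t • a) ⁻¹' M)) :=
        measure_mono fun y hy => hinv t (a, y) hy
    _ = ν (Prod.mk (t • a) ⁻¹' M) := hν.2 t _ (hM.fiber _).measurableSet
    _ ≤ ν (Prod.mk b ⁻¹' M) + ν (Prod.mk (t • a) ⁻¹' M \ Prod.mk b ⁻¹' M) := by
        refine (measure_mono ?_).trans (measure_union_le _ _)
        simp
    _ ≤ _ := by gcongr; exact ht.le

theorem measure_fiber_diff_smul [ν.OuterRegular] [ContinuousConstSMul T Y]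
    (hmin : SFMinimal T X) (hν : SFInvariantMeasure T ν)
    {M : Set (X × Y)} (hM : IsClosed M) (hinv : ∀ (t : T), ∀ p ∈ M, (t • p.1, t • p.2) ∈ M)
    (t : T) (a b : X) :
    ν (Prod.mk (t • a) ⁻¹' M \ Prod.mk (t • b) ⁻¹' M) =
      ν (Prod.mk a ⁻¹' M \ Prod.mk b ⁻¹' M) := by
  have hae : ∀ c : X,
      Prod.mk c ⁻¹' M =ᵐ[ν] (fun y => t • y) ⁻¹' (Prod.mk (t • c) ⁻¹' M) := fun c => by
    refine ae_eq_of_subset_of_measure_ge (fun y hy => hinv t (c, y) hy) ?_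
      (hM.fiber c).measurableSet.nullMeasurableSet (measure_ne_top ν _)
    rw [hν.2 t _ (hM.fiber _).measurableSet, measure_fiber_eq hmin hν hM hinv (t • c) c]
  rw [measure_congr ((hae a).diff (hae b)), ← preimage_sdiff,
    hν.2 t _ ((hM.fiber _).measurableSet.diff (hM.fiber _).measurableSet)]

end FiberMeasure

/-- The fibers of a closed invariant relation over regionally proximal points agree up to
null sets. -/
theorem measure_fiber_diff_eq_zero {T X Y : Type*} [Monoid T]
    [UniformSpace X] [CompactSpace X] [MulAction T X]
    [TopologicalSpace Y] [CompactSpace Y] [MulAction T Y] [ContinuousConstSMul T Y]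
    [MeasurableSpace Y] [BorelSpace Y] {ν : Measure Y} [ν.OuterRegular]
    (hmin : SFMinimal T X) (hν : SFInvariantMeasure T ν)
    {M : Set (X × Y)} (hM : IsClosed M) (hinv : ∀ (t : T), ∀ p ∈ M, (t • p.1, t • p.2) ∈ M)
    {x y : X} (hxy : (x, y) ∈ SFRegionallyProximal T X) :
    ν (Prod.mk y ⁻¹' M \ Prod.mk x ⁻¹' M) = 0 := by
  have := hν.1
  set d : X → X → ENNReal := fun a b => ν (Prod.mk a ⁻¹' M \ Prod.mk b ⁻¹' M)
  have hcomm : ∀ a b, d a b = d b a := fun a b =>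
    measure_sdiff_symm (hM.fiber a).measurableSet.nullMeasurableSet
      (hM.fiber b).measurableSet.nullMeasurableSet (measure_fiber_eq hmin hν hM hinv a b)
      (measure_ne_top ν _)
  have htri : ∀ a b c, d a c ≤ d a b + d b c := fun a b c =>
    measure_diff_le_add_measure_diff _ _ _
  have hnear : ∀ (a : X) {ε : ENNReal}, ε ≠ 0 → ∀ᶠ b in 𝓝 a, d b a < ε := fun a _ hε =>
    eventually_measure_fiber_diff_lt hM a hε
  refine le_antisymm (ENNReal.le_of_forall_pos_le_add fun ε hε _ => ?_) zero_le
  have hε3 : (ε : ENNReal) / 3 ≠ 0 := by simp [hε.ne']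
  have hε6 : (ε : ENNReal) / 3 / 2 ≠ 0 := by simp [hε.ne']
  have hV : {p : X × X | d p.1 p.2 < (ε : ENNReal) / 3} ∈ 𝓤 X := by
    rw [← nhdsSet_diagonal_eq_uniformity, mem_nhdsSet_iff_forall]
    rintro ⟨a, b⟩ hab
    obtain rfl : a = b := hab
    rw [nhds_prod_eq]
    filter_upwards [(hnear a hε6).prod_mk (hnear a hε6)] with p hp
    calc d p.1 p.2 ≤ d p.1 a + d a p.2 := htri _ _ _
      _ < (ε : ENNReal) / 3 / 2 + (ε : ENNReal) / 3 / 2 := by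
          rw [hcomm a]; exact ENNReal.add_lt_add hp.1 hp.2
      _ = (ε : ENNReal) / 3 := ENNReal.add_halves _
  have hcl := mem_iInter₂.1 hxy _ hV
  have hn : {p : X × X | d p.1 x < (ε : ENNReal) / 3 ∧ d p.2 y < (ε : ENNReal) / 3} ∈ 𝓝 (x, y) := by
    rw [nhds_prod_eq]
    exact (hnear x hε3).prod_mk (hnear y hε3)
  obtain ⟨⟨a, b⟩, ⟨ha, hb⟩, t, ht⟩ := mem_closure_iff_nhds.1 hcl _ hn
  have hab : d a b < (ε : ENNReal) / 3 :=
    (measure_fiber_diff_smul hmin hν hM hinv t a b).symm.trans_lt ht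
  calc d y x ≤ d y b + (d b a + d a x) := (htri y b x).trans (by gcongr; exact htri b a x)
    _ ≤ (ε : ENNReal) / 3 + ((ε : ENNReal) / 3 + (ε : ENNReal) / 3) := by
        rw [hcomm y b, hcomm b a]
        gcongr
    _ = 0 + ε := by rw [← add_assoc, ENNReal.add_thirds, zero_add]

/-- An invariant probability measure on a compact Hausdorff space can be replaced by a regular
one. -/
theorem exists_regular_invariantMeasure {T X : Type*} [Monoid T]
    [TopologicalSpace X] [CompactSpace X] [T2Space X] [MulAction T X] [ContinuousConstSMul T X]
    [MeasurableSpace X] [BorelSpace X] {μ : Measure X} (hμ : SFInvariantMeasure T μ) :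
    ∃ ν : Measure X, ν.Regular ∧ SFInvariantMeasure T ν := by
  have := hμ.1
  obtain ⟨ν, hreg, hfin, hint⟩ := μ.exists_regular_eq_of_compactSpace
  refine ⟨ν, hreg, ⟨?_⟩, fun t B hB => ?_⟩
  · have h1 := hint 1
    simp only [BoundedContinuousFunction.coe_one, Pi.one_apply, integral_const, smul_eq_mul,
      mul_one, probReal_univ] at h1
    rw [← ENNReal.ofReal_toReal (measure_ne_top ν univ)]
    change ENNReal.ofReal (ν.real univ) = 1
    rw [← h1, ENNReal.ofReal_one]
  · have ht : Continuous fun x : X => t • x := continuous_const_smul t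
    have hmap : μ.map (fun x => t • x) = μ := by
      ext B hB
      rw [Measure.map_apply ht.measurable hB, hμ.2 t B hB]
    have hin : (ν.map fun x => t • x).InnerRegular := Measure.InnerRegular.map_of_continuous ht
    have hν : ν.map (fun x => t • x) = ν := by
      refine Measure.ext_of_integral_eq_on_compactlySupported fun f => ?_
      have hf : ∀ m : Measure X, ∫ x, f x ∂(m.map fun x => t • x) = ∫ x, f (t • x) ∂m := fun m =>
        integral_map ht.aemeasurable f.continuous.aestronglyMeasurable
      have h1 := hint (BoundedContinuousFunction.mkOfCompact ⟨fun x => f (t • x), by fun_prop⟩)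
      have h2 := hint (BoundedContinuousFunction.mkOfCompact ⟨f, f.continuous⟩)
      simp only [BoundedContinuousFunction.mkOfCompact_apply, ContinuousMap.coe_mk] at h1 h2
      rw [hf, ← h1, ← h2, ← hf, hmap]
    rw [← Measure.map_apply ht.measurable hB, hν]

/-- Invariant measures of minimal semiflows have full support. -/
theorem SFInvariantMeasure.isOpenPosMeasure {T X : Type*} [Monoid T]
    [TopologicalSpace X] [CompactSpace X] [MulAction T X] [ContinuousConstSMul T X]
    [MeasurableSpace X] [BorelSpace X] {ν : Measure X} (hmin : SFMinimal T X)
    (hν : SFInvariantMeasure T ν) : ν.IsOpenPosMeasure := by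
  have := hν.1
  refine ⟨fun U hU hne h0 => ?_⟩
  obtain ⟨s, hs⟩ := isCompact_univ.elim_finite_subcover
    (fun t : T => (fun x : X => t • x) ⁻¹' U) (fun t => hU.preimage (continuous_const_smul t))
    fun x _ => by
      obtain ⟨_, hzU, t, rfl⟩ := (hmin x).inter_open_nonempty U hU hne
      exact mem_iUnion.2 ⟨t, hzU⟩
  have hnull : ν (⋃ t ∈ s, (fun x : X => t • x) ⁻¹' U) = 0 :=
    (measure_biUnion_null_iff s.countable_toSet).2 fun t _ => by
      rw [hν.2 t U hU.measurableSet, h0]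
  exact one_ne_zero ((measure_univ (μ := ν)).symm.trans (measure_mono_null hs hnull))

/-- If `(x, y)` is regionally proximal and `U` is an open neighborhood of `x`, then the orbit
closure of `{y} × U` contains the diagonal. -/
theorem diagonal_mem_closure_of_regionallyProximal {T X : Type*} [Monoid T]
    [UniformSpace X] [CompactSpace X] [T2Space X] [MulAction T X] [ContinuousConstSMul T X]
    [MeasurableSpace X] [BorelSpace X] (hmin : SFMinimal T X)
    (hmeas : ∃ μ : Measure X, SFInvariantMeasure T μ) {x y : X}
    (hxy : (x, y) ∈ SFRegionallyProximal T X) {U : Set X} (hU : IsOpen U) (hx : x ∈ U) (z : X) :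
    (z, z) ∈ closure {p : X × X | ∃ t : T, ∃ u ∈ U, (t • y, t • u) = p} := by
  obtain ⟨μ, hμ⟩ := hmeas
  obtain ⟨ν, hreg, hν⟩ := exists_regular_invariantMeasure hμ
  have hpos := hν.isOpenPosMeasure hmin
  set M := closure {p : X × X | ∃ t : T, ∃ u ∈ U, (t • y, t • u) = p}
  have hM : IsClosed M := isClosed_closure
  have hinv : ∀ (t : T), ∀ p ∈ M, (t • p.1, t • p.2) ∈ M := fun t p hp => by
    refine map_mem_closure (f := fun p : X × X => (t • p.1, t • p.2)) (by fun_prop) hp ?_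
    rintro _ ⟨s, u, hu, rfl⟩
    exact ⟨t * s, u, hu, by simp [mul_smul]⟩
  have hUM : U ⊆ Prod.mk y ⁻¹' M := fun u hu => subset_closure ⟨1, u, hu, by simp⟩
  have hnull : ν (U \ Prod.mk x ⁻¹' M) = 0 :=
    measure_mono_null
      (sdiff_subset_sdiff_left hUM)
      (measure_fiber_diff_eq_zero hmin hν hM hinv hxy)
  have hempty : U \ Prod.mk x ⁻¹' M = ∅ :=
    ((hU.sdiff (hM.fiber x)).measure_eq_zero_iff ν).1 hnull
  have hxx : (x, x) ∈ M := sdiff_eq_empty.1 hempty hx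
  have hdiag : IsClosed {w : X | (w, w) ∈ M} := hM.preimage (by fun_prop)
  exact hdiag.closure_subset_iff.2 (by rintro _ ⟨t, rfl⟩; exact hinv t _ hxx) (hmin x z)

/-- Regional proximality is equivalent to the existence of nets `xₙ → x` and `tₙ` such that
`tₙxₙ` and `tₙy` converge to a prescribed point `z`. -/
theorem regionallyProximal_iff_of_minimal {T X : Type*} [Monoid T]
    [UniformSpace X] [CompactSpace X] [T2Space X] [MulAction T X] [ContinuousConstSMul T X]
    [MeasurableSpace X] [BorelSpace X] (hmin : SFMinimal T X)
    (hmeas : ∃ μ : Measure X, SFInvariantMeasure T μ) (x y z : X) :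
    (x, y) ∈ SFRegionallyProximal T X ↔
      ∀ ε ∈ 𝓤 X, ∃ (x' : X) (t : T), (x, x') ∈ ε ∧ (z, t • x') ∈ ε ∧ (z, t • y) ∈ ε := by
  constructor
  · intro hxy ε hε
    have hball : ∀ w : X, UniformSpace.ball w ε ∈ 𝓝 w := fun w => UniformSpace.ball_mem_nhds w hε
    have hsub : interior (UniformSpace.ball x ε) ⊆ UniformSpace.ball x ε := interior_subset
    obtain ⟨_, ⟨h1, h2⟩, t, u, hu, rfl⟩ := mem_closure_iff_nhds.1
      (diagonal_mem_closure_of_regionallyProximal hmin hmeas hxy isOpen_interior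
        (mem_interior_iff_mem_nhds.2 (hball x)) z) _ (prod_mem_nhds (hball z) (hball z))
    exact ⟨u, t, hsub hu, h2, h1⟩
  · intro h
    refine mem_iInter₂.2 fun ε hε => mem_closure_iff_nhds.2 fun N hN => ?_
    obtain ⟨δ, hδ, hsymm, hcomp⟩ := comp_symm_mem_uniformity_sets hε
    have hx : {x' | (x', y) ∈ N} ∈ 𝓝 x :=
      (Continuous.prodMk_left y).continuousAt.preimage_mem_nhds hN
    obtain ⟨η, hη, hηN⟩ := UniformSpace.mem_nhds_iff.1 hx
    obtain ⟨x', t, h1, h2, h3⟩ := h (δ ∩ η) (inter_mem hδ hη)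
    exact ⟨(x', y), hηN h1.2, t, hcomp ⟨z, hsymm.symm _ _ h2.1, h3.1⟩⟩

/-- For a minimal semiflow `(T,X)` with an invariant measure,
`(x,y) ∈ Q(X)` iff one of the nets in the definition can be taken constant:
there are nets `xₙ → x`, `tₙ` with `tₙxₙ → x` and `tₙy → x`; equivalently there are
nets `xₙ → x`, `sₙ` with `sₙxₙ → y` and `sₙy → y`. -/
theorem stmt15 (T : Type*) (X : Type u) [Monoid T] [TopologicalSpace T]
    [UniformSpace X] [CompactSpace X] [T2Space X]
    [MulAction T X] [ContinuousSMul T X]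
    [MeasurableSpace X] [BorelSpace X]
    (hmin : SFMinimal T X)
    (hmeas : ∃ μ : Measure X, SFInvariantMeasure T μ)
    (x y : X) :
    ((x, y) ∈ SFRegionallyProximal T X ↔
      ∀ ε ∈ 𝓤 X, ∃ (x' : X) (t : T),
        (x, x') ∈ ε ∧ (x, t • x') ∈ ε ∧ (x, t • y) ∈ ε) ∧
    ((x, y) ∈ SFRegionallyProximal T X ↔
      ∀ ε ∈ 𝓤 X, ∃ (x' : X) (s : T),
        (x, x') ∈ ε ∧ (y, s • x') ∈ ε ∧ (y, s • y) ∈ ε) := by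
  exact ⟨regionallyProximal_iff_of_minimal hmin hmeas x y x,
    regionallyProximal_iff_of_minimal hmin hmeas x y y⟩
end

section
/- Let (T,X) be a minimal semiflow admitting an invariant measure. Then for every y ∈ X, the regionally proximal cell of y satisfies Q[y] = ⋂_{α} cls( ⋃_{t ∈ T} (t⁻¹α)[y] ), where the intersection is over all entourages α of X, (t⁻¹α)[y] = { x ∈ X : (ty, tx) ∈ α }, and Q[y] = { x ∈ X : (y,x) ∈ Q(X) }. -/
open Filter Topology Set Function MeasureTheory
open scoped Uniformity symmDiff

universe u v

section RegularInvariantMeasure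

/-- On a compact Hausdorff space, an invariant measure may be replaced by a regular one. -/
theorem SFInvariantMeasure.exists_regular {T X : Type*} [SMul T X] [TopologicalSpace X]
    [CompactSpace X] [T2Space X] [ContinuousConstSMul T X] [MeasurableSpace X] [BorelSpace X]
    {μ : Measure X} (hμ : SFInvariantMeasure T μ) :
    ∃ ν : Measure X, ν.Regular ∧ SFInvariantMeasure T ν := by
  obtain ⟨hprob, hinv⟩ := hμ
  obtain ⟨ν, hreg, hfin, hint⟩ := μ.exists_regular_eq_of_compactSpace
  refine ⟨ν, hreg, ⟨?_⟩, fun t B hB => ?_⟩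
  · have h := hint (BoundedContinuousFunction.const X 1)
    simp only [BoundedContinuousFunction.const_apply, integral_const, smul_eq_mul, mul_one,
      probReal_univ] at h
    rw [← ENNReal.ofReal_one, h, ofReal_measureReal]
  · have hc : Continuous fun x : X => t • x := continuous_const_smul t
    have hmap : μ.map (fun x => t • x) = μ :=
      Measure.ext fun B hB => by rw [Measure.map_apply hc.measurable hB, hinv t B hB]
    have : (ν.map fun x => t • x).InnerRegularCompactLTTop :=
      Measure.InnerRegularCompactLTTop.map_of_continuous hc
    have : IsFiniteMeasure (ν.map fun x => t • x) := Measure.isFiniteMeasure_map ν _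
    have hmapν : ν.map (fun x => t • x) = ν := by
      refine Measure.ext_of_integral_eq_on_compactlySupported fun f => ?_
      have hf : Continuous f := f.continuous
      have hf₀ := hint (BoundedContinuousFunction.mkOfCompact ⟨f, hf⟩)
      have hf₁ := hint (BoundedContinuousFunction.mkOfCompact ⟨fun x => f (t • x), hf.comp hc⟩)
      simp only [BoundedContinuousFunction.mkOfCompact_apply, ContinuousMap.coe_mk] at hf₀ hf₁
      rw [integral_map hc.aemeasurable hf.aestronglyMeasurable, ← hf₁, ← hf₀]
      conv_rhs => rw [← hmap]
      rw [integral_map hc.aemeasurable hf.aestronglyMeasurable]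
    conv_rhs => rw [← hmapν]
    rw [Measure.map_apply hc.measurable hB]

/-- An invariant measure of a minimal semiflow on a compact space has full support. -/
theorem SFInvariantMeasure.measure_ne_zero_of_isOpen {T X : Type*} [SMul T X] [TopologicalSpace X]
    [CompactSpace X] [ContinuousConstSMul T X] [MeasurableSpace X] [BorelSpace X]
    {μ : Measure X} (hμ : SFInvariantMeasure T μ) (hmin : SFMinimal T X)
    {U : Set X} (hU : IsOpen U) (hne : U.Nonempty) : μ U ≠ 0 := by
  obtain ⟨hprob, hinv⟩ := hμ
  intro h0
  have hcover : univ ⊆ ⋃ t : T, (fun x : X => t • x) ⁻¹' U := fun x _ => by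
    obtain ⟨_, hz, t, rfl⟩ := (hmin x).inter_open_nonempty U hU hne
    exact mem_iUnion.2 ⟨t, hz⟩
  obtain ⟨F, hF⟩ := isCompact_univ.elim_finite_subcover _
    (fun t : T => hU.preimage (continuous_const_smul t)) hcover
  have hnull : μ (⋃ t ∈ F, (fun x : X => t • x) ⁻¹' U) = 0 :=
    (measure_biUnion_null_iff F.countable_toSet).2 fun t _ => by
      rw [hinv t U hU.measurableSet, h0]
  exact one_ne_zero (measure_univ.symm.trans (measure_mono_null hF hnull))

end RegularInvariantMeasure

section SliceMeasure

/-- The slices of a closed subset of a product with compact second factor vary upper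
semicontinuously. -/
theorem IsClosed.eventually_preimage_mk_subset {X Y : Type*} [TopologicalSpace X]
    [TopologicalSpace Y] [CompactSpace Y] {J : Set (X × Y)} (hJ : IsClosed J) {z : X} {V : Set Y}
    (hV : IsOpen V) (hzV : Prod.mk z ⁻¹' J ⊆ V) : ∀ᶠ a in 𝓝 z, Prod.mk a ⁻¹' J ⊆ V := by
  have hcl : IsClosed (Prod.fst '' (J ∩ Prod.snd ⁻¹' Vᶜ)) :=
    isClosedMap_fst_of_compactSpace _ (hJ.inter (hV.isClosed_compl.preimage continuous_snd))
  have hz : z ∉ Prod.fst '' (J ∩ Prod.snd ⁻¹' Vᶜ) := by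
    rintro ⟨⟨_, w⟩, ⟨hw, hwV⟩, rfl⟩
    exact hwV (hzV hw)
  filter_upwards [hcl.isOpen_compl.mem_nhds hz] with a ha w hw
  by_contra hwV
  exact ha ⟨(a, w), ⟨hw, hwV⟩, rfl⟩

variable {T X Y : Type*} [SMul T X] [SMul T Y] [TopologicalSpace Y] [CompactSpace Y]
  [MeasurableSpace Y] [BorelSpace Y] {μ : Measure Y} {J : Set (X × Y)}

theorem measure_preimage_mk_eq [TopologicalSpace X] [μ.OuterRegular]
    (hμ : SFInvariantMeasure T μ) (hmin : SFMinimal T X) (hJ : IsClosed J)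
    (hinv : ∀ (t : T), ∀ p ∈ J, (t • p.1, t • p.2) ∈ J) (a b : X) :
    μ (Prod.mk a ⁻¹' J) = μ (Prod.mk b ⁻¹' J) := by
  suffices h : ∀ a b : X, μ (Prod.mk a ⁻¹' J) ≤ μ (Prod.mk b ⁻¹' J) from
    le_antisymm (h a b) (h b a)
  intro a b
  obtain ⟨hprob, hinvμ⟩ := hμ
  refine le_of_forall_gt fun r hr => ?_
  obtain ⟨V, hbV, hV, hVr⟩ := Set.exists_isOpen_lt_of_lt _ r hr
  obtain ⟨_, ⟨t, rfl⟩, hO⟩ := (hmin a).inter_nhds_nonempty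
    (hJ.eventually_preimage_mk_subset hV hbV)
  have hslice : MeasurableSet (Prod.mk (t • a) ⁻¹' J) :=
    (hJ.preimage (Continuous.prodMk_right _)).measurableSet
  calc μ (Prod.mk a ⁻¹' J)
      ≤ μ ((fun w => t • w) ⁻¹' (Prod.mk (t • a) ⁻¹' J)) :=
        measure_mono fun w hw => hinv t (a, w) hw
    _ = μ (Prod.mk (t • a) ⁻¹' J) := hinvμ t _ hslice
    _ ≤ μ V := measure_mono hO
    _ < r := hVr

theorem measure_preimage_mk_sdiff_le_smul [TopologicalSpace X] [ContinuousConstSMul T Y]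
    [μ.OuterRegular]
    (hμ : SFInvariantMeasure T μ) (hmin : SFMinimal T X) (hJ : IsClosed J)
    (hinv : ∀ (t : T), ∀ p ∈ J, (t • p.1, t • p.2) ∈ J) (t : T) (a b : X) :
    μ (Prod.mk a ⁻¹' J \ Prod.mk b ⁻¹' J) ≤
      μ (Prod.mk (t • a) ⁻¹' J \ Prod.mk (t • b) ⁻¹' J) := by
  have hprob := hμ.1
  have hslice (c : X) : MeasurableSet (Prod.mk c ⁻¹' J) :=
    (hJ.preimage (Continuous.prodMk_right c)).measurableSet
  have hsub (c : X) : Prod.mk c ⁻¹' J ⊆ (fun w => t • w) ⁻¹' (Prod.mk (t • c) ⁻¹' J) :=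
    fun w hw => hinv t (c, w) hw
  have hnull : μ ((fun w => t • w) ⁻¹' (Prod.mk (t • b) ⁻¹' J) \ Prod.mk b ⁻¹' J) = 0 := by
    rw [measure_sdiff (hsub b) (hslice b).nullMeasurableSet (measure_ne_top _ _),
      hμ.2 t _ (hslice _), measure_preimage_mk_eq hμ hmin hJ hinv (t • b) b, tsub_self]
  calc μ (Prod.mk a ⁻¹' J \ Prod.mk b ⁻¹' J)
      ≤ μ ((fun w => t • w) ⁻¹' (Prod.mk (t • a) ⁻¹' J \ Prod.mk (t • b) ⁻¹' J) ∪
          ((fun w => t • w) ⁻¹' (Prod.mk (t • b) ⁻¹' J) \ Prod.mk b ⁻¹' J)) := by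
        refine measure_mono fun w hw => ?_
        by_cases h : t • w ∈ Prod.mk (t • b) ⁻¹' J
        · exact Or.inr ⟨h, hw.2⟩
        · exact Or.inl ⟨hsub a hw.1, h⟩
    _ ≤ _ := measure_union_le _ _
    _ = μ (Prod.mk (t • a) ⁻¹' J \ Prod.mk (t • b) ⁻¹' J) := by
        rw [hnull, add_zero, hμ.2 t _ ((hslice _).diff (hslice _))]

theorem eventually_measure_preimage_mk_sdiff_lt [TopologicalSpace X] [μ.OuterRegular]
    (hμ : SFInvariantMeasure T μ) (hmin : SFMinimal T X) (hJ : IsClosed J)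
    (hinv : ∀ (t : T), ∀ p ∈ J, (t • p.1, t • p.2) ∈ J) (z : X) {ε : ENNReal} (hε : ε ≠ 0) :
    ∀ᶠ a in 𝓝 z, μ (Prod.mk a ⁻¹' J \ Prod.mk z ⁻¹' J) < ε ∧
      μ (Prod.mk z ⁻¹' J \ Prod.mk a ⁻¹' J) < ε := by
  have hprob := hμ.1
  have hslice (c : X) : MeasurableSet (Prod.mk c ⁻¹' J) :=
    (hJ.preimage (Continuous.prodMk_right c)).measurableSet
  obtain ⟨V, hzV, hV, -, hVε⟩ :=
    (hslice z).exists_isOpen_sdiff_lt (μ := μ) (measure_ne_top _ _) hε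
  filter_upwards [hJ.eventually_preimage_mk_subset hV hzV] with a ha
  have hlt : μ (Prod.mk a ⁻¹' J \ Prod.mk z ⁻¹' J) < ε :=
    (measure_mono (sdiff_subset_sdiff_left ha)).trans_lt hVε
  refine ⟨hlt, ?_⟩
  rwa [measure_sdiff_symm (hslice z).nullMeasurableSet (hslice a).nullMeasurableSet
    (measure_preimage_mk_eq hμ hmin hJ hinv z a) (measure_ne_top _ _)]

/-- The slices of a closed invariant set over regionally proximal points agree up to a null set. -/
theorem measure_preimage_mk_sdiff_eq_zero [UniformSpace X] [CompactSpace X]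
    [ContinuousConstSMul T Y] [μ.OuterRegular]
    (hμ : SFInvariantMeasure T μ) (hmin : SFMinimal T X) (hJ : IsClosed J)
    (hinv : ∀ (t : T), ∀ p ∈ J, (t • p.1, t • p.2) ∈ J) {x y : X}
    (hxy : (x, y) ∈ SFRegionallyProximal T X) :
    μ (Prod.mk x ⁻¹' J \ Prod.mk y ⁻¹' J) = 0 := by
  set d : X → X → ENNReal := fun a b => μ (Prod.mk a ⁻¹' J \ Prod.mk b ⁻¹' J)
  have htri (a b c : X) : d a c ≤ d a b + d b c :=
    (measure_mono (sdiff_triangle _ _ _)).trans (measure_union_le _ _)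
  have hnear (z : X) {ε : ENNReal} (hε : ε ≠ 0) : ∀ᶠ a in 𝓝 z, d a z < ε ∧ d z a < ε :=
    eventually_measure_preimage_mk_sdiff_lt hμ hmin hJ hinv z hε
  suffices h : ∀ ε : ENNReal, 0 < ε → d x y ≤ ε + ((ε + ε) + ε) by
    refine le_antisymm (ge_of_tendsto (x := 𝓝[>] (0 : ENNReal)) ?_
      (eventually_nhdsWithin_of_forall h)) zero_le
    have hlim : Tendsto (fun ε : ENNReal => ε + ((ε + ε) + ε)) (𝓝 0) (𝓝 (0 + ((0 + 0) + 0))) :=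
      tendsto_id.add ((tendsto_id.add tendsto_id).add tendsto_id)
    simpa using hlim.mono_left nhdsWithin_le_nhds
  intro ε hε
  obtain ⟨δ, hδ, hδε⟩ := lebesgue_number_lemma_nhds (isCompact_univ (X := X))
    fun z _ => hnear z hε.ne'
  obtain ⟨p, ⟨hpx, hpy⟩, t, ht⟩ := mem_closure_iff_nhds.1 (mem_iInter₂.1 hxy δ hδ) _
    (prod_mem_nhds (hnear x hε.ne') (hnear y hε.ne'))
  obtain ⟨z, hz⟩ := hδε (t • p.1) (mem_univ _)
  have h₁ : d (t • p.1) z < ε := (hz (UniformSpace.mem_ball_self _ hδ)).1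
  have h₂ : d z (t • p.2) < ε := (hz ht).2
  have hp : d p.1 p.2 ≤ ε + ε :=
    (measure_preimage_mk_sdiff_le_smul hμ hmin hJ hinv t p.1 p.2).trans
      ((htri _ z _).trans (add_le_add h₁.le h₂.le))
  exact (htri x p.1 y).trans (add_le_add hpx.2.le
    ((htri p.1 p.2 y).trans (add_le_add hp hpy.1.le)))

end SliceMeasure

/-- For a minimal semiflow `(T,X)` with an invariant measure, the
regionally proximal cell satisfies `Q[y] = ⋂_α cls (⋃_{t ∈ T} (t⁻¹α)[y])`. -/
theorem stmt16 (T : Type*) (X : Type u) [Monoid T] [TopologicalSpace T]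
    [UniformSpace X] [CompactSpace X] [T2Space X]
    [MulAction T X] [ContinuousSMul T X]
    [MeasurableSpace X] [BorelSpace X]
    (hmin : SFMinimal T X)
    (hmeas : ∃ μ : Measure X, SFInvariantMeasure T μ) :
    ∀ y : X, {x : X | (y, x) ∈ SFRegionallyProximal T X} =
      ⋂ α ∈ 𝓤 X, closure (⋃ t : T, {x : X | (t • y, t • x) ∈ α}) := by
  obtain ⟨μ₀, hμ₀⟩ := hmeas
  obtain ⟨μ, hreg, hμ⟩ := hμ₀.exists_regular
  intro y
  ext x
  simp only [mem_ofPred_eq, mem_iInter]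
  constructor
  · intro hxy α hα
    rw [mem_closure_iff]
    intro U hU hxU
    let S : Set (X × X) := {p | ∃ t : T, ∃ u ∈ U, p = (t • y, t • u)}
    have hinv (t : T) : ∀ p ∈ closure S, (t • p.1, t • p.2) ∈ closure S := by
      intro p hp
      have hc : Continuous fun q : X × X => (t • q.1, t • q.2) := by fun_prop
      refine map_mem_closure (f := fun q : X × X => (t • q.1, t • q.2)) hc hp ?_
      rintro _ ⟨s, u, hu, rfl⟩
      exact ⟨t * s, u, hu, by simp only [mul_smul]⟩
    have hyU : U ⊆ Prod.mk y ⁻¹' closure S := fun u hu =>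
      subset_closure ⟨1, u, hu, by simp only [one_smul]⟩
    have hnull := measure_preimage_mk_sdiff_eq_zero hμ hmin isClosed_closure hinv hxy
    have hopen : IsOpen (U \ Prod.mk x ⁻¹' closure S) :=
      hU.sdiff (isClosed_closure.preimage (Continuous.prodMk_right x))
    have hxS : (x, x) ∈ closure S := by
      by_contra hxS
      exact hμ.measure_ne_zero_of_isOpen hmin hopen ⟨x, hxU, hxS⟩
        (measure_mono_null (sdiff_subset_sdiff_left hyU) hnull)
    obtain ⟨_, hα', t, u, hu, rfl⟩ := mem_closure_iff_nhds.1 hxS α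
      (nhds_le_uniformity x hα)
    exact ⟨u, hu, mem_iUnion.2 ⟨t, hα'⟩⟩
  · intro h
    refine mem_iInter₂.2 fun α hα => ?_
    refine map_mem_closure (Continuous.prodMk_right y) (h α hα) fun z hz => ?_
    obtain ⟨t, ht⟩ := mem_iUnion.1 hz
    exact ⟨t, ht⟩
end

section
/- Let (T,X) be a weak-mixing semiflow on a compact Hausdorff space X which is not a singleton. Then (T,X) is sensitive to initial conditions: there exists an entourage ε of X such that for every x ∈ X and every entourage δ there are y ∈ δ[x] and t ∈ T with (tx, ty) ∉ ε. -/
open Filter Topology Set Function MeasureTheory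
open scoped Uniformity symmDiff

universe u v

/-- A weak-mixing semiflow on a non-singleton compact Hausdorff space is
sensitive to initial conditions. -/
theorem stmt19 (T : Type*) (X : Type u) [Monoid T] [TopologicalSpace T]
    [UniformSpace X] [CompactSpace X] [T2Space X]
    [MulAction T X] [ContinuousSMul T X]
    (hX : Nontrivial X)
    (hwm : SFWeakMixing T X) :
    ∃ ε ∈ 𝓤 X, ∀ x : X, ∀ δ ∈ 𝓤 X,
      ∃ y : X, (x, y) ∈ δ ∧ ∃ t : T, (t • x, t • y) ∉ ε := by
  obtain ⟨a, b, hab⟩ := hX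
  obtain ⟨V, hV, hVab⟩ : ∃ V ∈ 𝓤 X, (a, b) ∉ V := by
    by_contra! h
    exact hab (eq_of_uniformity fun {V} hV => h V hV)
  obtain ⟨W, ⟨hW, hWclosed⟩, hWV⟩ := uniformity_hasBasis_closed.mem_iff.1 hV
  obtain ⟨ε, hε, hεsymm, hεW⟩ := comp_symm_mem_uniformity_sets hW
  refine ⟨ε, hε, fun x δ hδ => ?_⟩
  by_contra! h
  have hx : x ∈ interior (UniformSpace.ball x δ) :=
    mem_interior_iff_mem_nhds.2 (UniformSpace.ball_mem_nhds x hδ)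
  obtain ⟨t, ⟨y, z⟩, ⟨hy, hz⟩, hyz⟩ := hwm _ _ (isOpen_interior.prod isOpen_interior)
    ⟨(x, x), hx, hx⟩ hWclosed.isOpen_compl ⟨(a, b), fun hmem => hVab (hWV hmem)⟩
  have hxy : y ∈ UniformSpace.ball x δ := interior_subset hy
  have hxz : z ∈ UniformSpace.ball x δ := interior_subset hz
  exact hyz (hεW ⟨t • x, SetRel.symm ε (h y hxy t), h z hxz t⟩)
end
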